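/- Let N be a positive integer, p ∈ (0, 1/2], M ∈ ℝ^{N×N} an arbitrary real matrix, and V a nonempty finite subset of ℝ^N. Let ε and ε' be independent transductive Rademacher vectors with parameter p. Then E_ε[ sup_{v ∈ V} |⟨ε, M v⟩| ] ≤ (1/(2p)) · E_{ε, ε'}[ |εᵀ M ε'| · sup_{v ∈ V} |⟨ε', v⟩| ]. -/

import Mathlib

open Finset

/-- Expectation with respect to a transductive Rademacher vector
`ε ∈ ℝ^N` with i.i.d. coordinates: `P(ε_i = 1) = P(ε_i = -1) = p`,
`P(ε_i = 0) = 1 - 2p`. -/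
noncomputable def tExp (N : ℕ) (p : ℝ) (f : (Fin N → ℝ) → ℝ) : ℝ :=
  ∑ s : Fin N → Fin 3,
    (∏ i, (![p, p, 1 - 2 * p] : Fin 3 → ℝ) (s i)) *
      f (fun i => (![(1 : ℝ), -1, 0]) (s i))

theorem tExp_prod (N : ℕ) (p : ℝ) (g : Fin N → ℝ → ℝ) :
    tExp N p (fun ε => ∏ i, g i (ε i)) =
      ∏ i, (p * g i 1 + p * g i (-1) + (1 - 2 * p) * g i 0) := by
  simp only [tExp, ← Finset.prod_mul_distrib]
  rw [← Fintype.piFinset_univ, ← Finset.prod_univ_sum (fun _ => Finset.univ)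
    (fun i k => (![p, p, 1 - 2 * p] : Fin 3 → ℝ) k * g i ((![(1 : ℝ), -1, 0]) k))]
  simp [Fin.sum_univ_three]

theorem tExp_mono {N : ℕ} {p : ℝ} (hp0 : 0 ≤ p) (hp : p ≤ 1 / 2)
    {f g : (Fin N → ℝ) → ℝ} (h : ∀ ε, f ε ≤ g ε) : tExp N p f ≤ tExp N p g := by
  refine Finset.sum_le_sum fun s _ => mul_le_mul_of_nonneg_left (h _) ?_
  refine Finset.prod_nonneg fun i _ => ?_
  generalize s i = k
  fin_cases k <;> simp <;> linarith

theorem tExp_const_mul (N : ℕ) (p c : ℝ) (f : (Fin N → ℝ) → ℝ) :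
    tExp N p (fun ε => c * f ε) = c * tExp N p f := by
  simp only [tExp, Finset.mul_sum]
  exact Finset.sum_congr rfl fun s _ => by ring

theorem tExp_sum {ι : Type*} (N : ℕ) (p : ℝ) (t : Finset ι) (f : ι → (Fin N → ℝ) → ℝ) :
    tExp N p (fun ε => ∑ j ∈ t, f j ε) = ∑ j ∈ t, tExp N p (f j) := by
  simp only [tExp, Finset.mul_sum]
  exact Finset.sum_comm

theorem abs_tExp_le {N : ℕ} {p : ℝ} (hp0 : 0 ≤ p) (hp : p ≤ 1 / 2)
    (f : (Fin N → ℝ) → ℝ) : |tExp N p f| ≤ tExp N p (fun ε => |f ε|) := by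
  refine abs_le'.2 ⟨tExp_mono hp0 hp fun ε => le_abs_self _, ?_⟩
  have := tExp_const_mul N p (-1) f
  rw [← neg_one_mul, ← this]
  exact tExp_mono hp0 hp fun ε => by simpa using neg_le_abs (f ε)

theorem tExp_coord_mul_coord (N : ℕ) (p : ℝ) (i j : Fin N) :
    tExp N p (fun ε => ε i * ε j) = if i = j then 2 * p else 0 := by
  have key := tExp_prod N p
    (fun k x => (if k = i then x else 1) * (if k = j then x else 1))
  simp only [Finset.prod_mul_distrib, Finset.prod_ite_eq', Finset.mem_univ, if_true] at key
  rw [key]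
  split_ifs with hij
  · subst hij
    rw [Finset.prod_eq_single i]
    · simp; ring
    · intro k _ hk
      simp [hk]; ring
    · simp
  · exact Finset.prod_eq_zero (Finset.mem_univ i) (by simp [hij])

theorem tExp_inner_mul_inner (N : ℕ) (p : ℝ) (a v : Fin N → ℝ) :
    tExp N p (fun ε => (∑ i, a i * ε i) * ∑ j, ε j * v j) = 2 * p * ∑ i, a i * v i := by
  have h : (fun ε : Fin N → ℝ => (∑ i, a i * ε i) * ∑ j, ε j * v j) =
      fun ε => ∑ i, ∑ j, (a i * v j) * (ε i * ε j) := by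
    funext ε
    rw [Finset.sum_mul_sum]
    exact Finset.sum_congr rfl fun i _ => Finset.sum_congr rfl fun j _ => by ring
  rw [h]
  simp only [tExp_sum, tExp_const_mul, tExp_coord_mul_coord, mul_ite, mul_zero,
    Finset.sum_ite_eq, Finset.mem_univ, if_true, Finset.mul_sum]
  exact Finset.sum_congr rfl fun i _ => by ring

/-- Decoupling step: introducing an independent transductive Rademacher copy
`ε'` inside the supremum via the covariance identity `E[ε' ε'ᵀ] = 2p I`. -/
theorem rademacher_decoupling
    (N : ℕ) (hN : 0 < N) (p : ℝ) (hp0 : 0 < p) (hp : p ≤ 1 / 2)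
    (M : Matrix (Fin N) (Fin N) ℝ)
    (V : Finset (Fin N → ℝ)) (hV : V.Nonempty) :
    tExp N p (fun ε => V.sup' hV (fun v => |∑ n, ε n * M.mulVec v n|))
      ≤ (1 / (2 * p)) *
        tExp N p (fun ε => tExp N p (fun ε' =>
          |∑ i, ε i * M.mulVec ε' i| * V.sup' hV (fun v => |∑ n, ε' n * v n|))) := by
  have h_adj : ∀ ε v : Fin N → ℝ,
      ∑ n, ε n * M.mulVec v n = ∑ n, Matrix.vecMul ε M n * v n :=
    fun ε v => Matrix.dotProduct_mulVec ε M v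
  rw [← tExp_const_mul]
  refine tExp_mono hp0.le hp fun ε => Finset.sup'_le hV _ fun v hv => ?_
  simp only [h_adj ε]
  have h_cov := tExp_inner_mul_inner N p (Matrix.vecMul ε M) v
  calc |∑ n, Matrix.vecMul ε M n * v n|
      = 1 / (2 * p) * |2 * p * ∑ n, Matrix.vecMul ε M n * v n| := by
        rw [abs_mul, abs_of_pos (by positivity : 0 < 2 * p)]
        field_simp
    _ ≤ _ := by
        rw [← h_cov]
        refine mul_le_mul_of_nonneg_left ((abs_tExp_le hp0.le hp _).trans ?_) (by positivity)
        refine tExp_mono hp0.le hp fun ε' => ?_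
        rw [abs_mul]
        exact mul_le_mul_of_nonneg_left
          (Finset.le_sup' (fun v => |∑ n, ε' n * v n|) hv) (abs_nonneg _)
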